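/- Smooth interpolation of boundary-collar reparametrizations (key analytic construction in the proof of Theorem A.1 of the paper): Let η > 0 and c > 0 be real numbers. Then there exist a real number δ with 0 < δ < η/2 and an infinitely differentiable function a : ℝ → ℝ with 0 ≤ a(t) ≤ 1 for all t, a(t) = 0 for all t ∈ [0, δ], and a(t) = 1 for all t ∈ [η − δ, η], such that for every differentiable function τ : ℝ → ℝ with τ(0) = 0 and τ'(t) ≥ c for all t ∈ [0, η], the function τ̂ : ℝ → ℝ defined by τ̂(t) = (1 − a(t))·t + a(t)·τ(t) satisfies: τ̂'(t) > 0 for all t ∈ [0, η]; τ̂(t) = t for all t ∈ [0, δ]; and τ̂(t) = τ(t) for all t ∈ [η − δ, η]. (In particular, for every s ∈ [0, 1] the convex combination τ_s = s·τ̂ + (1 − s)·τ has strictly positive derivative on [0, η], so all τ_s are strictly increasing there.) -/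

import Mathlib

open Set

open Filter Topology in
/-- The derivative of the smooth transition function is bounded. -/
theorem exists_pos_deriv_smoothTransition_le :
    ∃ M : ℝ, 0 < M ∧ ∀ x, deriv Real.smoothTransition x ≤ M := by
  have hcont : Continuous (deriv Real.smoothTransition) :=
    (Real.smoothTransition.contDiff (n := 1)).continuous_deriv le_rfl
  obtain ⟨C, hC⟩ := isCompact_Icc.exists_bound_of_continuousOn
    (s := Icc (0 : ℝ) 1) hcont.continuousOn
  refine ⟨max C 1, by positivity, fun x => ?_⟩
  by_cases hx : x ∈ Icc (0 : ℝ) 1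
  · exact (le_abs_self _).trans ((hC x hx).trans (le_max_left _ _))
  have hzero : deriv Real.smoothTransition x = 0 := by
    rcases lt_or_ge x 0 with h | h
    · have heq : Real.smoothTransition =ᶠ[𝓝 x] fun _ => 0 := by
        filter_upwards [Iio_mem_nhds h] with y hy
        exact Real.smoothTransition.zero_of_nonpos (le_of_lt hy)
      rw [heq.deriv_eq, deriv_const]
    · have h' : 1 < x := by
        by_contra! h'
        exact hx ⟨h, h'⟩
      have heq : Real.smoothTransition =ᶠ[𝓝 x] fun _ => 1 := by
        filter_upwards [Ioi_mem_nhds h'] with y hy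
        exact Real.smoothTransition.one_of_one_le (le_of_lt hy)
      rw [heq.deriv_eq, deriv_const]
  rw [hzero]
  positivity

open Filter Topology in
/-- There is a smooth cutoff from `0` near `0` to `1` near `η` whose logarithmic slope
`t * deriv a t` is as small as desired. -/
theorem exists_smooth_cutoff_mul_deriv_le {η ε : ℝ} (hη : 0 < η) (hε : 0 < ε) :
    ∃ δ : ℝ, 0 < δ ∧ δ < η / 2 ∧ ∃ a : ℝ → ℝ, ContDiff ℝ (⊤ : ℕ∞) a ∧
      (∀ t, 0 ≤ a t ∧ a t ≤ 1) ∧ (∀ t ≤ δ, a t = 0) ∧ (∀ t, η - δ ≤ t → a t = 1) ∧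
      ∀ t, 0 ≤ deriv a t ∧ t * deriv a t ≤ ε := by
  obtain ⟨M, hM, hSM⟩ := exists_pos_deriv_smoothTransition_le
  set k := ε / M with hk
  have hk0 : 0 < k := by positivity
  set E := Real.exp k⁻¹ with hE
  have hE0 : 0 < E := Real.exp_pos _
  set δ := η / (E + 2) with hδ
  have hδ0 : 0 < δ := by positivity
  have hδE : δ * (E + 2) = η := by rw [hδ]; field_simp
  have hδη : δ < η / 2 := by nlinarith [mul_pos hδ0 hE0]
  set g : ℝ → ℝ := fun t => Real.smoothTransition (k * (Real.log t - Real.log δ)) with hg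
  set a : ℝ → ℝ := fun t => if t ≤ 0 then 0 else g t with ha
  have ha_zero : ∀ t ≤ δ, a t = 0 := by
    intro t ht
    by_cases h : t ≤ 0
    · simp [ha, h]
    · have : Real.log t ≤ Real.log δ := Real.log_le_log (not_le.1 h) ht
      simp only [ha, h, if_false, hg]
      exact Real.smoothTransition.zero_of_nonpos
        (mul_nonpos_of_nonneg_of_nonpos hk0.le (sub_nonpos.2 this))
  have ha_pos : ∀ t, 0 < t → a =ᶠ[𝓝 t] g := by
    intro t ht
    filter_upwards [Ioi_mem_nhds ht] with y hy
    simp [ha, not_le.2 (mem_Ioi.1 hy)]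
  have ha_low : ∀ t, t < δ → a =ᶠ[𝓝 t] fun _ => 0 := by
    intro t ht
    filter_upwards [Iio_mem_nhds ht] with y hy
    exact ha_zero y (le_of_lt hy)
  have hmono : Monotone Real.smoothTransition := Real.smoothTransition.monotone
  refine ⟨δ, hδ0, hδη, a, ?_, ?_, ha_zero, ?_, ?_⟩
  · rw [contDiff_iff_contDiffAt]
    intro t
    rcases lt_or_ge t δ with h | h
    · exact contDiffAt_const.congr_of_eventuallyEq (ha_low t h)
    · have ht : 0 < t := hδ0.trans_le h
      refine ContDiffAt.congr_of_eventuallyEq ?_ (ha_pos t ht)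
      exact Real.smoothTransition.contDiffAt.comp t
        (contDiffAt_const.mul ((Real.contDiffAt_log.2 ht.ne').sub contDiffAt_const))
  · intro t
    by_cases h : t ≤ 0
    · simp [ha, h]
    · simp only [ha, h, if_false, hg]
      exact ⟨Real.smoothTransition.nonneg _, Real.smoothTransition.le_one _⟩
  · intro t ht
    have hEt : δ * E ≤ t := by nlinarith
    have ht0 : 0 < t := (mul_pos hδ0 hE0).trans_le hEt
    have hlog : Real.log δ + k⁻¹ ≤ Real.log t := by
      have := Real.log_le_log (mul_pos hδ0 hE0) hEt
      rwa [Real.log_mul hδ0.ne' hE0.ne', hE, Real.log_exp] at this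
    simp only [ha, not_le.2 ht0, if_false, hg]
    apply Real.smoothTransition.one_of_one_le
    calc (1 : ℝ) = k * k⁻¹ := (mul_inv_cancel₀ hk0.ne').symm
      _ ≤ k * (Real.log t - Real.log δ) := by gcongr; linarith
  · intro t
    rcases lt_or_ge t δ with h | h
    · rw [(ha_low t h).deriv_eq, deriv_const]
      simpa using hε.le
    · have ht : 0 < t := hδ0.trans_le h
      have hS : Differentiable ℝ Real.smoothTransition :=
        (Real.smoothTransition.contDiff (n := 1)).differentiable one_ne_zero
      have hderiv : deriv a t =
          deriv Real.smoothTransition (k * (Real.log t - Real.log δ)) * (k * t⁻¹) := by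
        rw [(ha_pos t ht).deriv_eq]
        exact ((hS _).hasDerivAt.comp t
          (((Real.hasDerivAt_log ht.ne').sub_const _).const_mul k)).deriv
      rw [hderiv]
      refine ⟨mul_nonneg hmono.deriv_nonneg (by positivity), ?_⟩
      calc t * (deriv Real.smoothTransition (k * (Real.log t - Real.log δ)) * (k * t⁻¹))
          = deriv Real.smoothTransition (k * (Real.log t - Real.log δ)) * k := by
            field_simp
        _ ≤ M * k := by gcongr; exact hSM _
        _ = ε := by rw [hk]; field_simp

/-- Smooth interpolation of boundary-collar reparametrizations: for `η > 0` and
`c > 0` there are `0 < δ < η/2` and a smooth cutoff `a : ℝ → ℝ` with values in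
`[0,1]`, vanishing on `[0,δ]` and equal to `1` on `[η-δ,η]`, such that for every
differentiable `τ : ℝ → ℝ` with `τ 0 = 0` and `deriv τ ≥ c` on `[0,η]`, the
interpolation `τ̂ t = (1 - a t) * t + a t * τ t` has strictly positive
derivative on `[0,η]`, equals `t` on `[0,δ]` and equals `τ` on `[η-δ,η]`. -/
theorem smooth_collar_interpolation (η c : ℝ) (hη : 0 < η) (hc : 0 < c) :
    ∃ δ : ℝ, 0 < δ ∧ δ < η / 2 ∧
      ∃ a : ℝ → ℝ, ContDiff ℝ (⊤ : ℕ∞) a ∧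
        (∀ t : ℝ, 0 ≤ a t ∧ a t ≤ 1) ∧
        (∀ t ∈ Icc (0 : ℝ) δ, a t = 0) ∧
        (∀ t ∈ Icc (η - δ) η, a t = 1) ∧
        ∀ τ : ℝ → ℝ, Differentiable ℝ τ → τ 0 = 0 →
          (∀ t ∈ Icc (0 : ℝ) η, c ≤ deriv τ t) →
          (∀ t ∈ Icc (0 : ℝ) η,
              0 < deriv (fun t => (1 - a t) * t + a t * τ t) t) ∧
          (∀ t ∈ Icc (0 : ℝ) δ, (1 - a t) * t + a t * τ t = t) ∧
          (∀ t ∈ Icc (η - δ) η, (1 - a t) * t + a t * τ t = τ t) := by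
  have hm0 : 0 < min c (1 / 2) := by positivity
  obtain ⟨δ, hδ0, hδη, a, ha, ha01, ha_zero, ha_one, ha'⟩ :=
    exists_smooth_cutoff_mul_deriv_le hη hm0
  refine ⟨δ, hδ0, hδη, a, ha, ha01, fun t ht => ha_zero t ht.2, fun t ht => ha_one t ht.1, ?_⟩
  intro τ hτ hτ0 hτc
  refine ⟨fun t ht => ?_, fun t ht => ?_, fun t ht => ?_⟩
  · have hτt : c * t ≤ τ t := by
      have := (convex_Icc (0 : ℝ) η).mul_sub_le_image_sub_of_le_deriv
        hτ.continuous.continuousOn hτ.differentiableOn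
        (fun x hx => hτc x (interior_subset hx)) 0 ⟨le_rfl, hη.le⟩ t ht ht.1
      simpa [hτ0] using this
    have hat : HasDerivAt a (deriv a t) t := (ha.differentiable (by simp) t).hasDerivAt
    have hd := ((hat.const_sub 1).mul (hasDerivAt_id t)).add (hat.mul (hτ t).hasDerivAt)
    have hd' : deriv (fun t => (1 - a t) * t + a t * τ t) t =
        -deriv a t * t + (1 - a t) * 1 + (deriv a t * τ t + a t * deriv τ t) := hd.deriv
    rw [hd']
    obtain ⟨hd0, hdε⟩ := ha' t
    obtain ⟨h0, h1⟩ := ha01 t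
    set m := min c (1 / 2)
    have hmc : m ≤ c := min_le_left _ _
    have hm_half : m ≤ 1 / 2 := min_le_right _ _
    have hderiv : a t * m ≤ a t * deriv τ t :=
      mul_le_mul_of_nonneg_left (hmc.trans (hτc t ht)) h0
    have hval : deriv a t * (m * t) ≤ deriv a t * τ t :=
      mul_le_mul_of_nonneg_left ((mul_le_mul_of_nonneg_right hmc ht.1).trans hτt) hd0
    have hslope : (1 - m) * (t * deriv a t) ≤ (1 - m) * m :=
      mul_le_mul_of_nonneg_left hdε (by linarith)
    have hcut : (1 - m) * a t ≤ (1 - m) * 1 :=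
      mul_le_mul_of_nonneg_left h1 (by linarith)
    nlinarith [mul_pos hm0 hm0]
  · rw [ha_zero t ht.2]
    ring
  · rw [ha_one t ht.1]
    ring
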